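/- Let G = (I, A, src, tgt, o, d) be a condensed DAG with R nonempty, let A_O be a finite set, π : A → A_O a map, s_b : [0,∞) → [0,∞) a strictly increasing continuous function for each b ∈ A_O, g_o > 0, and β > 0. Then a Condensed DAG equilibrium exists, is unique, and is the unique minimizer of F over W: there is exactly one w̄ ∈ W satisfying the equilibrium equations, and for all w ∈ W with w ≠ w̄, F(w̄) < F(w). -/

import Mathlib

/-- A condensed DAG: finite node set `I`, finite arc set `A`, arc endpoint maps
`src, tgt : A → I`, distinct origin `o` and destination `d`, no directed cycles,
and every arc lies on at least one route from `o` to `d`. -/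
structure CondensedDAG (I : Type*) (A : Type*) [Fintype I] [Fintype A] where
  src : A → I
  tgt : A → I
  o : I
  d : I
  o_ne_d : o ≠ d
  /-- No directed cycle: there is no nonempty chain of consecutive arcs whose
  last arc's target is the first arc's source. -/
  acyclic : ∀ (a : A) (l : List A),
      List.Chain' (fun x y => tgt x = src y) (a :: l) →
      tgt ((a :: l).getLast (List.cons_ne_nil a l)) ≠ src a
  /-- Every arc lies on at least one route from `o` to `d`. -/
  covered : ∀ a : A, ∃ r : List A,
      (r ≠ [] ∧ (∀ b ∈ r.head?, src b = o) ∧ (∀ b ∈ r.getLast?, tgt b = d) ∧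
        List.Chain' (fun x y => tgt x = src y) r) ∧ a ∈ r

namespace CondensedDAG

variable {I A : Type*} [Fintype I] [Fintype A]

/-- A route: a nonempty list of consecutive arcs starting at `o` and ending at `d`. -/
def IsRoute (G : CondensedDAG I A) (r : List A) : Prop :=
  r ≠ [] ∧ (∀ b ∈ r.head?, G.src b = G.o) ∧ (∀ b ∈ r.getLast?, G.tgt b = G.d) ∧
    List.Chain' (fun x y => G.tgt x = G.src y) r

/-- The depth `ℓ_a` of an arc: the largest (1-based) position at which `a`
occurs in some route. -/
noncomputable def depth (G : CondensedDAG I A) (a : A) : ℕ :=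
  sSup {k : ℕ | 1 ≤ k ∧ ∃ r : List A, G.IsRoute r ∧ r[k - 1]? = some a}

/-- The depth `ℓ(G)` of the condensed DAG: maximal depth over all arcs. -/
noncomputable def graphDepth (G : CondensedDAG I A) : ℕ :=
  sSup (Set.range G.depth)

/-- The height `m_a` of an arc: the largest value of `|r| + 1 - ℓ_{a,r}` over
routes `r` containing `a` at (1-based) position `ℓ_{a,r}`. -/
noncomputable def height (G : CondensedDAG I A) (a : A) : ℕ :=
  sSup {k : ℕ | ∃ (r : List A) (j : ℕ), G.IsRoute r ∧ 1 ≤ j ∧ r[j - 1]? = some a ∧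
    k = r.length + 1 - j}

/-- The height `m(G)` of the condensed DAG: maximal height over all arcs. -/
noncomputable def graphHeight (G : CondensedDAG I A) : ℕ :=
  sSup (Set.range G.height)

end CondensedDAG

namespace CondensedDAG

variable {I A : Type*} [Fintype I] [Fintype A] [DecidableEq I]

/-- The feasible flow set `W`: nonnegative arc flows with total outflow `gO` at
the origin and flow conservation at every intermediate node. -/
def feasible (G : CondensedDAG I A) (gO : ℝ) : Set (A → ℝ) :=
  {w | (∀ a, 0 ≤ w a) ∧
    (∑ a ∈ Finset.univ.filter (fun a => G.src a = G.o), w a) = gO ∧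
    ∀ i : I, i ≠ G.o → i ≠ G.d →
      (∑ a ∈ Finset.univ.filter (fun a => G.src a = i), w a) =
        (∑ a ∈ Finset.univ.filter (fun a => G.tgt a = i), w a)}

/-- The objective `F(w) = Σ_b ∫_0^{w_[b]} s_b + (1/β) Σ_{i ≠ d} χ_i(w_{A_i^+})`,
where `w_[b]` is the total flow on arcs projecting to `b ∈ A_O` and `χ_i` is the
entropy term at node `i` (with the convention `0 ln 0 = 0`, automatic since
`Real.log 0 = 0`). -/
noncomputable def objF {A_O : Type*} [Fintype A_O] [DecidableEq A_O]
    (G : CondensedDAG I A) (π : A → A_O) (s : A_O → ℝ → ℝ) (β : ℝ)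
    (w : A → ℝ) : ℝ :=
  (∑ b : A_O, ∫ u in (0:ℝ)..(∑ a ∈ Finset.univ.filter (fun a => π a = b), w a), s b u) +
    (1 / β) * ∑ i ∈ Finset.univ.filter (fun i : I => i ≠ G.d),
      ((∑ a ∈ Finset.univ.filter (fun a => G.src a = i), w a * Real.log (w a)) -
        (∑ a ∈ Finset.univ.filter (fun a => G.src a = i), w a) *
          Real.log (∑ a ∈ Finset.univ.filter (fun a => G.src a = i), w a))

end CondensedDAG

namespace CondensedDAG

variable {I A : Type*} [Fintype I] [Fintype A] [DecidableEq I]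

/-- `z` is the latency-to-go vector associated with the flow `w`:
`z_a = s_{π a}(w_{[π a]})` for arcs ending at the destination, and
`z_a = s_{π a}(w_{[π a]}) - (1/β) ln Σ_{a' ∈ A_{tgt a}^+} exp(-β z_{a'})` otherwise. -/
def IsLatencyToGo {A_O : Type*} [Fintype A_O] [DecidableEq A_O]
    (G : CondensedDAG I A) (π : A → A_O) (s : A_O → ℝ → ℝ) (β : ℝ)
    (w : A → ℝ) (z : A → ℝ) : Prop :=
  ∀ a : A,
    (G.tgt a = G.d →
      z a = s (π a) (∑ a' ∈ Finset.univ.filter (fun a' => π a' = π a), w a')) ∧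
    (G.tgt a ≠ G.d →
      z a = s (π a) (∑ a' ∈ Finset.univ.filter (fun a' => π a' = π a), w a') -
        (1 / β) * Real.log
          (∑ a' ∈ Finset.univ.filter (fun a' => G.src a' = G.tgt a),
            Real.exp (-β * z a')))

/-- `w` is a Condensed DAG equilibrium: `w ∈ W` and, with `z = z(w)` the
latency-to-go vector, for every arc `a`,
`w_a = (g_{src a} + Σ_{a' ∈ A_{src a}^-} w_{a'}) · exp(-β z_a) / Σ_{a' ∈ A_{src a}^+} exp(-β z_{a'})`. -/
def IsEquilibrium {A_O : Type*} [Fintype A_O] [DecidableEq A_O]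
    (G : CondensedDAG I A) (π : A → A_O) (s : A_O → ℝ → ℝ) (β : ℝ) (gO : ℝ)
    (w : A → ℝ) : Prop :=
  w ∈ G.feasible gO ∧
    ∃ z : A → ℝ, G.IsLatencyToGo π s β w z ∧
      ∀ a : A, w a =
        ((if G.src a = G.o then gO else 0) +
            ∑ a' ∈ Finset.univ.filter (fun a' => G.tgt a' = G.src a), w a') *
          (Real.exp (-β * z a) /
            ∑ a' ∈ Finset.univ.filter (fun a' => G.src a' = G.src a),
              Real.exp (-β * z a'))

end CondensedDAG

/-- The entropy density `x log (x / (y p))` corrected by its tangent at `x = y p` is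
nonnegative, and it vanishes only at `x = y p`. -/
lemma entropy_gap {x y p : ℝ} (hx : 0 ≤ x) (hxy : x ≤ y) (hp : 0 < p) :
    0 ≤ x * Real.log x - x * Real.log y - x * Real.log p - x + y * p ∧
      (x * Real.log x - x * Real.log y - x * Real.log p - x + y * p = 0 ↔ x = y * p) := by
  rcases hx.eq_or_lt with rfl | hx
  · constructor
    · simpa using mul_nonneg hxy hp.le
    · simp [eq_comm]
  · have hy : 0 < y := hx.trans_le hxy
    have hr : 0 < y * p / x := by positivity
    have key : x * Real.log x - x * Real.log y - x * Real.log p - x + y * p =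
        x * (y * p / x - 1 - Real.log (y * p / x)) := by
      rw [Real.log_div (by positivity) hx.ne', Real.log_mul hy.ne' hp.ne']
      field_simp
      ring
    rw [key]
    constructor
    · have := Real.log_le_sub_one_of_pos hr
      exact mul_nonneg hx.le (by linarith)
    · refine ⟨fun h => ?_, fun h => by rw [← h, div_self hx.ne']; simp⟩
      by_contra hne
      have h1 : y * p / x ≠ 1 := by
        intro h1
        rw [div_eq_one_iff_eq hx.ne'] at h1
        exact hne h1.symm
      have := Real.log_lt_sub_one_of_pos hr h1
      have : 0 < x * (y * p / x - 1 - Real.log (y * p / x)) := mul_pos hx (by linarith)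
      linarith

/-- Joint convexity of `(x, y) ↦ x log (x / y)`. -/
lemma entropy_convex {x y x' y' t : ℝ} (hx : 0 ≤ x) (hxy : x ≤ y) (hx' : 0 ≤ x')
    (hxy' : x' ≤ y') (ht0 : 0 < t) (ht1 : t < 1) :
    ((1 - t) * x + t * x') * Real.log ((1 - t) * x + t * x') -
        ((1 - t) * x + t * x') * Real.log ((1 - t) * y + t * y') ≤
      (1 - t) * (x * Real.log x - x * Real.log y) +
        t * (x' * Real.log x' - x' * Real.log y') := by
  have ht : 0 < 1 - t := by linarith
  rcases hx.eq_or_lt with rfl | hx0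
  · rcases hx'.eq_or_lt with rfl | hx0'
    · simp
    · have hy : 0 < (1 - t) * y + t * y' := by
        have := mul_nonneg ht.le hxy
        have := mul_pos ht0 (hx0'.trans_le hxy')
        linarith
      have hX : 0 < (1 - t) * 0 + t * x' := by
        have := mul_pos ht0 hx0'
        linarith
      have hp := div_pos hX hy
      have h1 := mul_nonneg ht.le (entropy_gap hx hxy hp).1
      have h2 := mul_nonneg ht0.le (entropy_gap hx' hxy' hp).1
      have h3 : ((1 - t) * y + t * y') * (((1 - t) * 0 + t * x') / ((1 - t) * y + t * y')) =
          (1 - t) * 0 + t * x' := by field_simp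
      rw [Real.log_div hX.ne' hy.ne'] at h1 h2
      linarith
  · have hX : 0 < (1 - t) * x + t * x' := by
      have := mul_pos ht hx0
      have := mul_nonneg ht0.le hx'
      linarith
    have hy : 0 < (1 - t) * y + t * y' := by
      have := mul_pos ht (hx0.trans_le hxy)
      have := mul_nonneg ht0.le (hx'.trans hxy')
      linarith
    have hp := div_pos hX hy
    have h1 := mul_nonneg ht.le (entropy_gap hx hxy hp).1
    have h2 := mul_nonneg ht0.le (entropy_gap hx' hxy' hp).1
    have h3 : ((1 - t) * y + t * y') * (((1 - t) * x + t * x') / ((1 - t) * y + t * y')) =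
        (1 - t) * x + t * x' := by field_simp
    rw [Real.log_div hX.ne' hy.ne'] at h1 h2
    linarith

/-- Definition of a real function by well-founded recursion, as an existence statement. -/
lemma exists_of_wellFounded_recursion {I : Type*} {r : I → I → Prop} (hr : WellFounded r)
    (H : I → (I → ℝ) → ℝ)
    (hH : ∀ i f g, (∀ j, r j i → f j = g j) → H i f = H i g) :
    ∃ f : I → ℝ, ∀ i, f i = H i f := by
  classical
  let f : I → ℝ := hr.fix fun i F => H i fun j => if hj : r j i then F j hj else 0
  refine ⟨f, fun i => ?_⟩
  have h : f i = H i fun j => if r j i then f j else 0 := hr.fix_eq _ i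
  rw [h]
  exact hH _ _ _ fun j hj => by simp [hj]

/-- The integral of a continuous function that is monotone on `[0, ∞)` lies above its tangents. -/
lemma mul_sub_le_integral_sub {f : ℝ → ℝ} (hmono : MonotoneOn f (Set.Ici 0))
    (hcont : ContinuousOn f (Set.Ici 0)) {x y : ℝ} (hx : 0 ≤ x) (hy : 0 ≤ y) :
    f x * (y - x) ≤ (∫ u in (0 : ℝ)..y, f u) - ∫ u in (0 : ℝ)..x, f u := by
  have hint : ∀ {a b : ℝ}, 0 ≤ a → 0 ≤ b → IntervalIntegrable f MeasureTheory.volume a b :=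
    fun ha hb => (hcont.mono fun u hu => le_trans (le_min ha hb) hu.1).intervalIntegrable
  rw [intervalIntegral.integral_interval_sub_left (hint le_rfl hy) (hint le_rfl hx)]
  rcases le_total x y with h | h
  · have := intervalIntegral.integral_mono_on h intervalIntegrable_const (hint hx hy)
      (fun u hu => hmono hx (hx.trans hu.1) hu.1 : ∀ u ∈ Set.Icc x y, f x ≤ f u)
    simpa [mul_comm] using this
  · have := intervalIntegral.integral_mono_on h (hint hy hx) intervalIntegrable_const
      (fun u hu => hmono (hy.trans hu.1) hx hu.2 : ∀ u ∈ Set.Icc y x, f u ≤ f x)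
    rw [intervalIntegral.integral_symm]
    simp only [intervalIntegral.integral_const, smul_eq_mul] at this
    linarith

namespace CondensedDAG

variable {I A : Type*} [Fintype I] [Fintype A]

lemma exists_next (G : CondensedDAG I A) (a : A) (ha : G.tgt a ≠ G.d) :
    ∃ b, G.src b = G.tgt a := by
  obtain ⟨r, ⟨-, -, hl, hc⟩, har⟩ := G.covered a
  obtain ⟨l₁, l₂, rfl⟩ := List.append_of_mem har
  cases l₂ with
  | nil => exact absurd (hl a (by simp)) ha
  | cons b l =>
    have h : List.IsChain _ _ := hc
    exact ⟨b, ((List.isChain_append_cons_cons.1 h).2.1).symm⟩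

lemma src_ne_d (G : CondensedDAG I A) (a : A) : G.src a ≠ G.d := by
  intro ha
  obtain ⟨r, ⟨-, -, hl, hc⟩, har⟩ := G.covered a
  obtain ⟨l₁, l₂, rfl⟩ := List.append_of_mem har
  refine G.acyclic a l₂ (List.IsChain.right_of_append hc) ?_
  rw [ha]
  refine hl _ ?_
  rw [List.getLast?_append_of_ne_nil _ (List.cons_ne_nil _ _),
    List.getLast?_eq_getLast_of_ne_nil (List.cons_ne_nil _ _)]
  rfl

lemma tgt_ne_o (G : CondensedDAG I A) (a : A) : G.tgt a ≠ G.o := by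
  intro ha
  obtain ⟨r, ⟨-, hh, -, hc⟩, har⟩ := G.covered a
  obtain ⟨l₁, l₂, rfl⟩ := List.append_of_mem har
  cases l₁ with
  | nil =>
    have h1 := hh a (by simp)
    exact G.acyclic a [] (List.isChain_singleton a) (by simp [ha, h1])
  | cons c l =>
    have h1 := hh c (by simp)
    refine G.acyclic c (l ++ [a]) ?_ (by simp [ha, h1])
    have h : List.IsChain (fun x y => G.tgt x = G.src y) ((c :: (l ++ [a])) ++ l₂) := by
      have hc' : List.IsChain (fun x y => G.tgt x = G.src y) _ := hc
      simpa using hc'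
    exact h.left_of_append

lemma exists_src_eq_o (G : CondensedDAG I A) (hR : ∃ r : List A, G.IsRoute r) :
    ∃ a, G.src a = G.o := by
  obtain ⟨r, hne, hh, -⟩ := hR
  obtain ⟨a, l, rfl⟩ := List.exists_cons_of_ne_nil hne
  exact ⟨a, hh a (by simp)⟩

/-- A rank function on the nodes that decreases along every arc. -/
lemma exists_rank (G : CondensedDAG I A) : ∃ h : I → ℕ, ∀ a, h (G.tgt a) < h (G.src a) := by
  classical
  let E : I → I → Prop := fun i j => ∃ a, G.src a = i ∧ G.tgt a = j
  have hE : ∀ i j, Relation.TransGen E i j → ∃ a l,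
      List.IsChain (fun x y => G.tgt x = G.src y) (a :: l) ∧ G.src a = i ∧
        G.tgt ((a :: l).getLast (List.cons_ne_nil a l)) = j := by
    intro i j hij
    induction hij using Relation.TransGen.head_induction_on with
    | single h =>
      obtain ⟨a, rfl, rfl⟩ := h
      exact ⟨a, [], List.isChain_singleton a, rfl, rfl⟩
    | head h _ ih =>
      obtain ⟨a, rfl, ha⟩ := h
      obtain ⟨b, l, hc, hb, hl⟩ := ih
      exact ⟨a, b :: l, List.IsChain.cons_cons (ha.trans hb.symm) hc, rfl, by simpa using hl⟩
  have hirr : ∀ i, ¬ Relation.TransGen E i i := by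
    intro i hi
    obtain ⟨a, l, hc, ha, hl⟩ := hE i i hi
    exact G.acyclic a l hc (hl.trans ha.symm)
  refine ⟨fun i => (Finset.univ.filter fun j => Relation.TransGen E i j).card, fun a => ?_⟩
  have hstep : E (G.src a) (G.tgt a) := ⟨a, rfl, rfl⟩
  refine Finset.card_lt_card ⟨fun j hj => ?_, fun hsub => ?_⟩
  · simp only [Finset.mem_filter, Finset.mem_univ, true_and] at hj ⊢
    exact Relation.TransGen.head hstep hj
  · have : G.tgt a ∈ Finset.univ.filter fun j => Relation.TransGen E (G.src a) j := by
      simpa using Relation.TransGen.single hstep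
    have := hsub this
    simp only [Finset.mem_filter, Finset.mem_univ, true_and] at this
    exact hirr _ this

lemma wellFounded_upstream (h : I → ℕ) : WellFounded fun i j : I => h j < h i :=
  have : IsTrans I fun i j : I => h j < h i := ⟨fun _ _ _ h1 h2 => h2.trans h1⟩
  have : Std.Irrefl fun i j : I => h j < h i := ⟨fun _ => lt_irrefl _⟩
  Finite.wellFounded_of_trans_of_irrefl _

variable [DecidableEq I]

/-- Total flow leaving the node `i`. -/
def outflow (G : CondensedDAG I A) (w : A → ℝ) (i : I) : ℝ :=
  ∑ a ∈ Finset.univ.filter (fun a => G.src a = i), w a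

/-- Total flow entering the node `i`. -/
def inflow (G : CondensedDAG I A) (w : A → ℝ) (i : I) : ℝ :=
  ∑ a ∈ Finset.univ.filter (fun a => G.tgt a = i), w a

/-- The entropy part of the objective, summed over arcs rather than nodes. -/
noncomputable def entropy (G : CondensedDAG I A) (w : A → ℝ) : ℝ :=
  ∑ a, (w a * Real.log (w a) - w a * Real.log (G.outflow w (G.src a)))

/-- The divergence of `w` from the flow that splits according to the proportions `p`. -/
noncomputable def divergence (G : CondensedDAG I A) (p w : A → ℝ) : ℝ :=
  ∑ a, (w a * Real.log (w a) - w a * Real.log (G.outflow w (G.src a)) - w a * Real.log (p a) -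
    w a + G.outflow w (G.src a) * p a)

/-- `p` gives positive splitting proportions at every node, and `V` is a node potential that
vanishes at the destination and turns the arc costs `c` into the log-proportions. -/
def IsLogitPotential (G : CondensedDAG I A) (β : ℝ) (c p : A → ℝ) (V : I → ℝ) : Prop :=
  (∀ a, 0 < p a) ∧ (∀ a, G.outflow p (G.src a) = 1) ∧
    (∀ a, c a = V (G.src a) - V (G.tgt a) - 1 / β * Real.log (p a)) ∧ V G.d = 0

lemma outflow_nonneg (G : CondensedDAG I A) {w : A → ℝ} (hw : ∀ a, 0 ≤ w a) (i : I) :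
    0 ≤ G.outflow w i :=
  Finset.sum_nonneg fun a _ => hw a

lemma le_outflow (G : CondensedDAG I A) {w : A → ℝ} (hw : ∀ a, 0 ≤ w a) (a : A) :
    w a ≤ G.outflow w (G.src a) :=
  Finset.single_le_sum (f := w) (fun b _ => hw b) (by simp)

lemma outflow_eq_zero_of_no_arc (G : CondensedDAG I A) (w : A → ℝ) {i : I}
    (hi : ¬ ∃ a, G.src a = i) : G.outflow w i = 0 := by
  rw [outflow, Finset.filter_false_of_mem, Finset.sum_empty]
  exact fun a _ ha => hi ⟨a, ha⟩

lemma outflow_d (G : CondensedDAG I A) (w : A → ℝ) : G.outflow w G.d = 0 :=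
  G.outflow_eq_zero_of_no_arc w fun ⟨a, ha⟩ => G.src_ne_d a ha

lemma inflow_o (G : CondensedDAG I A) (w : A → ℝ) : G.inflow w G.o = 0 := by
  rw [inflow, Finset.filter_false_of_mem, Finset.sum_empty]
  exact fun a _ => G.tgt_ne_o a

lemma sum_outflow_mul (G : CondensedDAG I A) (w : A → ℝ) (V : I → ℝ) :
    ∑ i, G.outflow w i * V i = ∑ a, w a * V (G.src a) := by
  rw [← Finset.sum_fiberwise Finset.univ G.src]
  refine Finset.sum_congr rfl fun i _ => ?_
  rw [outflow, Finset.sum_mul]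
  exact Finset.sum_congr rfl fun a ha => by rw [(Finset.mem_filter.1 ha).2]

lemma sum_inflow_mul (G : CondensedDAG I A) (w : A → ℝ) (V : I → ℝ) :
    ∑ i, G.inflow w i * V i = ∑ a, w a * V (G.tgt a) := by
  rw [← Finset.sum_fiberwise Finset.univ G.tgt]
  refine Finset.sum_congr rfl fun i _ => ?_
  rw [inflow, Finset.sum_mul]
  exact Finset.sum_congr rfl fun a ha => by rw [(Finset.mem_filter.1 ha).2]

lemma outflow_eq (G : CondensedDAG I A) {gO : ℝ} {w : A → ℝ} (hw : w ∈ G.feasible gO) {i : I}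
    (hi : i ≠ G.d) : G.outflow w i = (if i = G.o then gO else 0) + G.inflow w i := by
  split_ifs with h
  · subst h
    rw [inflow_o, add_zero]
    exact hw.2.1
  · rw [zero_add]
    exact hw.2.2 i h hi

lemma sum_mul_potential_sub (G : CondensedDAG I A) {gO : ℝ} {w : A → ℝ}
    (hw : w ∈ G.feasible gO) {V : I → ℝ} (hV : V G.d = 0) :
    ∑ a, w a * (V (G.src a) - V (G.tgt a)) = gO * V G.o := by
  simp_rw [mul_sub]
  rw [Finset.sum_sub_distrib, ← sum_outflow_mul, ← sum_inflow_mul, ← Finset.sum_sub_distrib]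
  have : ∀ i ∈ Finset.univ, G.outflow w i * V i - G.inflow w i * V i =
      if i = G.o then gO * V G.o else 0 := by
    intro i _
    by_cases hi : i = G.d
    · subst hi
      simp [hV, G.o_ne_d.symm]
    · rw [G.outflow_eq hw hi]
      split_ifs with h
      · rw [h]; ring
      · ring
  rw [Finset.sum_congr rfl this]
  simp

lemma sum_outflow_src_mul (G : CondensedDAG I A) {p : A → ℝ}
    (hp : ∀ a, G.outflow p (G.src a) = 1) (w : A → ℝ) :
    ∑ a, G.outflow w (G.src a) * p a = ∑ a, w a := by
  have h1 := G.sum_outflow_mul p (G.outflow w)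
  have h2 := G.sum_outflow_mul w fun _ => 1
  simp only [mul_one] at h2
  rw [← h2]
  simp_rw [mul_comm (G.outflow w _)]
  rw [← h1]
  refine Finset.sum_congr rfl fun i _ => ?_
  by_cases hi : ∃ a, G.src a = i
  · obtain ⟨a, rfl⟩ := hi
    rw [hp, one_mul]
  · rw [G.outflow_eq_zero_of_no_arc w hi, mul_zero]

lemma sum_cost_add_entropy (G : CondensedDAG I A) {β gO : ℝ} {c p : A → ℝ} {V : I → ℝ}
    (h : G.IsLogitPotential β c p V) {w : A → ℝ} (hw : w ∈ G.feasible gO) :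
    ∑ a, c a * w a + 1 / β * G.entropy w = gO * V G.o + 1 / β * G.divergence p w := by
  obtain ⟨-, hp1, hc, hV⟩ := h
  have h1 := G.sum_mul_potential_sub hw hV
  have h2 := G.sum_outflow_src_mul hp1 w
  have h3 : ∑ a, c a * w a = ∑ a, w a * (V (G.src a) - V (G.tgt a)) -
      1 / β * ∑ a, w a * Real.log (p a) := by
    rw [Finset.mul_sum, ← Finset.sum_sub_distrib]
    exact Finset.sum_congr rfl fun a _ => by rw [hc a]; ring
  have h4 : G.divergence p w = G.entropy w - ∑ a, w a * Real.log (p a) := by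
    simp only [divergence, entropy, Finset.sum_add_distrib, Finset.sum_sub_distrib] at *
    linarith
  rw [h3, h1, h4]
  ring

lemma divergence_nonneg (G : CondensedDAG I A) {p w : A → ℝ} (hp : ∀ a, 0 < p a)
    (hw : ∀ a, 0 ≤ w a) : 0 ≤ G.divergence p w :=
  Finset.sum_nonneg fun a _ => (entropy_gap (hw a) (G.le_outflow hw a) (hp a)).1

lemma divergence_eq_zero_iff (G : CondensedDAG I A) {p w : A → ℝ} (hp : ∀ a, 0 < p a)
    (hw : ∀ a, 0 ≤ w a) :
    G.divergence p w = 0 ↔ ∀ a, w a = G.outflow w (G.src a) * p a := by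
  rw [divergence, Finset.sum_eq_zero_iff_of_nonneg
    fun a _ => (entropy_gap (hw a) (G.le_outflow hw a) (hp a)).1]
  simp only [Finset.mem_univ, true_implies]
  exact forall_congr' fun a => (entropy_gap (hw a) (G.le_outflow hw a) (hp a)).2

lemma exists_split_flow (G : CondensedDAG I A) (hR : ∃ r : List A, G.IsRoute r) {gO : ℝ}
    (hgO : 0 ≤ gO) {p : A → ℝ} (hp : ∀ a, 0 < p a) (hp1 : ∀ a, G.outflow p (G.src a) = 1) :
    ∃ w ∈ G.feasible gO, ∀ a, w a = G.outflow w (G.src a) * p a := by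
  obtain ⟨h, hh⟩ := G.exists_rank
  obtain ⟨N, hN⟩ := exists_of_wellFounded_recursion (wellFounded_upstream h)
    (fun i N => (if i = G.o then gO else 0) +
      ∑ a ∈ Finset.univ.filter (fun a => G.tgt a = i), N (G.src a) * p a) (by
      intro i f g hfg
      refine congrArg _ (Finset.sum_congr rfl fun a ha => ?_)
      rw [hfg]
      rw [← (Finset.mem_filter.1 ha).2]
      exact hh a)
  have hN0 : ∀ i, 0 ≤ N i := by
    intro i
    induction i using (wellFounded_upstream h).induction with
    | _ i ih =>
      rw [hN]
      refine add_nonneg (by split_ifs <;> simp [hgO]) (Finset.sum_nonneg fun a ha => ?_)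
      refine mul_nonneg (ih _ ?_) (hp a).le
      rw [← (Finset.mem_filter.1 ha).2]
      exact hh a
  have hout : ∀ a, G.outflow (fun a => N (G.src a) * p a) (G.src a) = N (G.src a) := by
    intro a
    have : G.outflow (fun a => N (G.src a) * p a) (G.src a) =
        N (G.src a) * G.outflow p (G.src a) := by
      rw [outflow, outflow, Finset.mul_sum]
      exact Finset.sum_congr rfl fun b hb => by rw [(Finset.mem_filter.1 hb).2]
    rw [this, hp1, mul_one]
  refine ⟨fun a => N (G.src a) * p a, ⟨fun a => mul_nonneg (hN0 _) (hp a).le, ?_, ?_⟩,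
    fun a => by rw [hout]⟩
  · obtain ⟨a, ha⟩ := G.exists_src_eq_o hR
    have h1 := hout a
    rw [ha, hN, if_pos rfl] at h1
    have h2 := G.inflow_o fun a => N (G.src a) * p a
    rw [inflow] at h2
    rw [h2, add_zero] at h1
    exact h1
  · intro i hio hid
    by_cases hi : ∃ a, G.src a = i
    · obtain ⟨a, rfl⟩ := hi
      have h1 := hout a
      rw [hN, if_neg hio, zero_add] at h1
      exact h1
    · refine (G.outflow_eq_zero_of_no_arc _ hi).trans ?_
      rw [Finset.filter_false_of_mem, Finset.sum_empty]
      rintro a - rfl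
      exact hi (G.exists_next a hid)

lemma split_flow_unique (G : CondensedDAG I A) {gO : ℝ} {p w w' : A → ℝ}
    (hw : w ∈ G.feasible gO) (hw' : w' ∈ G.feasible gO)
    (h : ∀ a, w a = G.outflow w (G.src a) * p a)
    (h' : ∀ a, w' a = G.outflow w' (G.src a) * p a) : w = w' := by
  obtain ⟨r, hr⟩ := G.exists_rank
  have key : ∀ i, i ≠ G.d → G.outflow w i = G.outflow w' i := by
    intro i
    induction i using (wellFounded_upstream r).induction with
    | _ i ih =>
      intro hi
      rw [G.outflow_eq hw hi, G.outflow_eq hw' hi]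
      refine congrArg _ (Finset.sum_congr rfl fun a ha => ?_)
      rw [h, h', ih _ _ (G.src_ne_d a)]
      rw [← (Finset.mem_filter.1 ha).2]
      exact hr a
  funext a
  rw [h, h', key _ (G.src_ne_d a)]

lemma exists_latency (G : CondensedDAG I A) (β : ℝ) (c : A → ℝ) :
    ∃ z : A → ℝ, ∀ a, (G.tgt a = G.d → z a = c a) ∧
      (G.tgt a ≠ G.d → z a = c a - (1 / β) * Real.log
        (∑ b ∈ Finset.univ.filter (fun b => G.src b = G.tgt a), Real.exp (-β * z b))) := by
  obtain ⟨h, hh⟩ := G.exists_rank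
  obtain ⟨V, hV⟩ := exists_of_wellFounded_recursion (InvImage.wf h wellFounded_lt)
    (fun i V => if i = G.d then 0 else -((1 / β) * Real.log
      (∑ b ∈ Finset.univ.filter (fun b => G.src b = i), Real.exp (-β * (c b + V (G.tgt b)))))) (by
      intro i f g hfg
      split_ifs
      · rfl
      · refine congrArg (fun x => -((1 / β) * Real.log x)) (Finset.sum_congr rfl fun b hb => ?_)
        rw [hfg]
        rw [← (Finset.mem_filter.1 hb).2]
        exact hh b)
  refine ⟨fun a => c a + V (G.tgt a), fun a => ⟨fun ha => ?_, fun ha => ?_⟩⟩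
  · have h1 := (hV (G.tgt a)).trans (if_pos ha)
    simp [h1]
  · have h1 := (hV (G.tgt a)).trans (if_neg ha)
    beta_reduce
    linarith

lemma exists_isLogitPotential (G : CondensedDAG I A) {β : ℝ} (hβ : β ≠ 0) {c z : A → ℝ}
    (hz : ∀ a, (G.tgt a = G.d → z a = c a) ∧
      (G.tgt a ≠ G.d → z a = c a - (1 / β) * Real.log
        (∑ b ∈ Finset.univ.filter (fun b => G.src b = G.tgt a), Real.exp (-β * z b)))) :
    ∃ V, G.IsLogitPotential β c (fun a => Real.exp (-β * z a) /
      ∑ b ∈ Finset.univ.filter (fun b => G.src b = G.src a), Real.exp (-β * z b)) V := by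
  have hpos : ∀ a, 0 < ∑ b ∈ Finset.univ.filter (fun b => G.src b = G.src a),
      Real.exp (-β * z b) := fun a =>
    Finset.sum_pos (fun b _ => Real.exp_pos _) ⟨a, by simp⟩
  refine ⟨fun i => if i = G.d then 0 else -((1 / β) * Real.log
      (∑ b ∈ Finset.univ.filter (fun b => G.src b = i), Real.exp (-β * z b))),
    fun a => div_pos (Real.exp_pos _) (hpos a), fun a => ?_, fun a => ?_, if_pos rfl⟩
  · rw [← div_self (hpos a).ne', outflow, Finset.sum_div]
    exact Finset.sum_congr rfl fun b hb => by rw [(Finset.mem_filter.1 hb).2]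
  · beta_reduce
    rw [if_neg (G.src_ne_d a), Real.log_div (Real.exp_pos _).ne' (hpos a).ne', Real.log_exp]
    have hb : 1 / β * (-β * z a) = -z a := by field_simp
    rw [mul_sub, hb]
    split_ifs with h
    · rw [(hz a).1 h]; ring
    · have := (hz a).2 h
      linarith

lemma sum_le_mul_rank (G : CondensedDAG I A) {gO : ℝ} {w : A → ℝ} (hw : w ∈ G.feasible gO)
    {h : I → ℕ} (hh : ∀ a, h (G.tgt a) < h (G.src a)) :
    ∑ a, w a ≤ gO * ((h G.o : ℝ) - h G.d) := by
  rw [← G.sum_mul_potential_sub hw (V := fun i => (h i : ℝ) - h G.d) (sub_self _)]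
  refine Finset.sum_le_sum fun a _ => le_mul_of_one_le_right (hw.1 a) ?_
  have : (h (G.tgt a) : ℝ) + 1 ≤ h (G.src a) := by exact_mod_cast hh a
  linarith

lemma isCompact_feasible (G : CondensedDAG I A) (gO : ℝ) : IsCompact (G.feasible gO) := by
  obtain ⟨h, hh⟩ := G.exists_rank
  refine (isCompact_Icc (a := 0)
    (b := fun _ : A => gO * ((h G.o : ℝ) - h G.d))).of_isClosed_subset ?_ fun w hw =>
      ⟨hw.1, fun a => (Finset.single_le_sum (fun b _ => hw.1 b) (Finset.mem_univ a)).trans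
        (G.sum_le_mul_rank hw hh)⟩
  simp only [feasible, Set.ofPred_and, Set.ofPred_forall]
  refine IsClosed.inter (isClosed_iInter fun a => isClosed_le (by fun_prop) (by fun_prop))
    (IsClosed.inter (isClosed_eq (by fun_prop) (by fun_prop)) ?_)
  exact isClosed_iInter fun i => isClosed_iInter fun _ => isClosed_iInter fun _ =>
    isClosed_eq (by fun_prop) (by fun_prop)

lemma convex_feasible (G : CondensedDAG I A) (gO : ℝ) : Convex ℝ (G.feasible gO) := by
  intro w hw w' hw' a b ha hb hab
  refine ⟨fun x => ?_, ?_, fun i hio hid => ?_⟩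
  · exact add_nonneg (mul_nonneg ha (hw.1 x)) (mul_nonneg hb (hw'.1 x))
  · simp only [Pi.add_apply, Pi.smul_apply, smul_eq_mul, Finset.sum_add_distrib,
      ← Finset.mul_sum, hw.2.1, hw'.2.1]
    rw [← add_mul, hab, one_mul]
  · simp only [Pi.add_apply, Pi.smul_apply, smul_eq_mul, Finset.sum_add_distrib,
      ← Finset.mul_sum, hw.2.2 i hio hid, hw'.2.2 i hio hid]

lemma entropy_convexComb_le (G : CondensedDAG I A) {w w' : A → ℝ} (hw : ∀ a, 0 ≤ w a)
    (hw' : ∀ a, 0 ≤ w' a) {t : ℝ} (ht0 : 0 < t) (ht1 : t < 1) :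
    G.entropy ((1 - t) • w + t • w') ≤ (1 - t) * G.entropy w + t * G.entropy w' := by
  simp only [entropy, Finset.mul_sum]
  rw [← Finset.sum_add_distrib]
  refine Finset.sum_le_sum fun a _ => ?_
  have h : G.outflow ((1 - t) • w + t • w') (G.src a) =
      (1 - t) * G.outflow w (G.src a) + t * G.outflow w' (G.src a) := by
    simp [outflow, Finset.sum_add_distrib, Finset.mul_sum]
  rw [h]
  exact entropy_convex (hw a) (G.le_outflow hw a) (hw' a) (G.le_outflow hw' a) ht0 ht1

section Objective

variable {A_O : Type*} [DecidableEq A_O]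

/-- Total flow on the arcs that project to `b`. -/
def projFlow (π : A → A_O) (w : A → ℝ) (b : A_O) : ℝ :=
  ∑ a ∈ Finset.univ.filter (fun a => π a = b), w a

lemma projFlow_nonneg (π : A → A_O) {w : A → ℝ} (hw : ∀ a, 0 ≤ w a) (b : A_O) :
    0 ≤ projFlow π w b :=
  Finset.sum_nonneg fun a _ => hw a

lemma sum_mul_projFlow [Fintype A_O] (π : A → A_O) (w : A → ℝ) (f : A_O → ℝ) :
    ∑ b, f b * projFlow π w b = ∑ a, f (π a) * w a := by
  rw [← Finset.sum_fiberwise Finset.univ π]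
  refine Finset.sum_congr rfl fun b _ => ?_
  rw [projFlow, Finset.mul_sum]
  exact Finset.sum_congr rfl fun a ha => by rw [(Finset.mem_filter.1 ha).2]

variable [Fintype A_O]

lemma objF_eq (G : CondensedDAG I A) (π : A → A_O) (s : A_O → ℝ → ℝ) (β : ℝ) (w : A → ℝ) :
    G.objF π s β w =
      ∑ b, (∫ u in (0 : ℝ)..projFlow π w b, s b u) + 1 / β * G.entropy w := by
  have h : G.entropy w = ∑ i ∈ Finset.univ.filter (fun i : I => i ≠ G.d),
      ((∑ a ∈ Finset.univ.filter (fun a => G.src a = i), w a * Real.log (w a)) -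
        (∑ a ∈ Finset.univ.filter (fun a => G.src a = i), w a) *
          Real.log (∑ a ∈ Finset.univ.filter (fun a => G.src a = i), w a)) := by
    rw [entropy, Finset.sum_sub_distrib,
      ← G.sum_outflow_mul w (fun i => Real.log (G.outflow w i)),
      ← Finset.sum_fiberwise Finset.univ G.src fun a => w a * Real.log (w a),
      ← Finset.sum_sub_distrib, Finset.sum_filter]
    refine Finset.sum_congr rfl fun i _ => ?_
    split_ifs with hi
    · rfl
    · rw [not_not.1 hi, outflow_d, Finset.filter_false_of_mem fun a _ => G.src_ne_d a]
      simp
  rw [h]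
  rfl

lemma continuousOn_objF (G : CondensedDAG I A) (π : A → A_O) {s : A_O → ℝ → ℝ}
    (hcont : ∀ b, ContinuousOn (s b) (Set.Ici 0)) (β gO : ℝ) :
    ContinuousOn (G.objF π s β) (G.feasible gO) := by
  have hs : ∀ b, Continuous fun u => s b (max u 0) := fun b =>
    (hcont b).comp_continuous (by fun_prop) fun u => le_max_right u 0
  have hlog : ∀ f : (A → ℝ) → ℝ, Continuous f → Continuous fun w => f w * Real.log (f w) :=
    fun f hf => Real.continuous_mul_log.comp hf
  have hprim : ∀ b, Continuous fun w : A → ℝ => ∫ u in (0 : ℝ)..projFlow π w b, s b (max u 0) :=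
    fun b => (intervalIntegral.continuous_primitive
      (fun x y => (hs b).intervalIntegrable x y) 0).comp
        (continuous_finsetSum _ fun a _ => continuous_apply a)
  have hF : Continuous (G.objF π (fun b u => s b (max u 0)) β) := by
    unfold objF
    refine (continuous_finsetSum _ fun b _ => hprim b).add
      (continuous_const.mul (continuous_finsetSum _ fun i _ => Continuous.sub ?_ ?_))
    · exact continuous_finsetSum _ fun a _ => hlog _ (continuous_apply a)
    · exact hlog _ (continuous_finsetSum _ fun a _ => continuous_apply a)
  refine hF.continuousOn.congr fun w hw => ?_
  rw [objF_eq, objF_eq]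
  congr 1
  refine Finset.sum_congr rfl fun b _ => intervalIntegral.integral_congr fun u hu => ?_
  rw [Set.uIcc_of_le (projFlow_nonneg π hw.1 b)] at hu
  simp only [max_eq_left hu.1]

/-- First-order condition: a minimizer of the objective also minimizes the functional in which
the congestion cost is linearized at the minimizer. -/
lemma linearized_le_of_minimizer (G : CondensedDAG I A) (π : A → A_O) {s : A_O → ℝ → ℝ}
    (hmono : ∀ b, MonotoneOn (s b) (Set.Ici 0)) (hcont : ∀ b, ContinuousOn (s b) (Set.Ici 0))
    {β gO : ℝ} (hβ : 0 < β) {w : A → ℝ} (hw : w ∈ G.feasible gO)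
    (hmin : ∀ v ∈ G.feasible gO, G.objF π s β w ≤ G.objF π s β v) {v : A → ℝ}
    (hv : v ∈ G.feasible gO) :
    ∑ a, s (π a) (projFlow π w (π a)) * w a + 1 / β * G.entropy w ≤
      ∑ a, s (π a) (projFlow π w (π a)) * v a + 1 / β * G.entropy v := by
  have hcomb : ∀ (t : ℝ) b, projFlow π ((1 - t) • w + t • v) b =
      projFlow π w b + t * (projFlow π v b - projFlow π w b) := by
    intro t b
    simp only [projFlow, Pi.add_apply, Pi.smul_apply, smul_eq_mul, Finset.sum_add_distrib,
      ← Finset.mul_sum]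
    ring
  have hstep : ∀ t ∈ Set.Ioo (0 : ℝ) 1,
      0 ≤ ∑ b, s b (projFlow π w b + t * (projFlow π v b - projFlow π w b)) *
        (projFlow π v b - projFlow π w b) + 1 / β * (G.entropy v - G.entropy w) := by
    rintro t ⟨ht0, ht1⟩
    have hvt : (1 - t) • w + t • v ∈ G.feasible gO :=
      G.convex_feasible gO hw hv (by linarith) ht0.le (by ring)
    have h1 := hmin _ hvt
    rw [objF_eq, objF_eq] at h1
    have h2 := mul_le_mul_of_nonneg_left (G.entropy_convexComb_le hw.1 hv.1 ht0 ht1)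
      (one_div_pos.2 hβ).le
    have h3 : ∑ b, (∫ u in (0 : ℝ)..projFlow π ((1 - t) • w + t • v) b, s b u) -
        ∑ b, (∫ u in (0 : ℝ)..projFlow π w b, s b u) ≤
        t * ∑ b, s b (projFlow π w b + t * (projFlow π v b - projFlow π w b)) *
          (projFlow π v b - projFlow π w b) := by
      rw [← Finset.sum_sub_distrib, Finset.mul_sum]
      refine Finset.sum_le_sum fun b _ => ?_
      have := mul_sub_le_integral_sub (hmono b) (hcont b)
        (projFlow_nonneg π hvt.1 b) (projFlow_nonneg π hw.1 b)
      rw [hcomb] at this ⊢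
      linarith
    refine nonneg_of_mul_nonneg_right (a := t) ?_ ht0
    linarith
  have hlim : Filter.Tendsto (fun t : ℝ =>
      ∑ b, s b (projFlow π w b + t * (projFlow π v b - projFlow π w b)) *
        (projFlow π v b - projFlow π w b) + 1 / β * (G.entropy v - G.entropy w))
      (nhdsWithin 0 (Set.Ioo 0 1))
      (nhds (∑ b, s b (projFlow π w b) * (projFlow π v b - projFlow π w b) +
        1 / β * (G.entropy v - G.entropy w))) := by
    refine Filter.Tendsto.add_const _ (tendsto_finsetSum _ fun b _ =>
      Filter.Tendsto.mul_const _ ?_)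
    refine (hcont b _ (projFlow_nonneg π hw.1 b)).tendsto.comp
      (tendsto_nhdsWithin_iff.2 ⟨?_, ?_⟩)
    · refine tendsto_nhdsWithin_of_tendsto_nhds ?_
      have : Continuous fun t : ℝ =>
          projFlow π w b + t * (projFlow π v b - projFlow π w b) := by fun_prop
      simpa using this.tendsto 0
    · filter_upwards [self_mem_nhdsWithin] with t ht
      rw [← hcomb]
      exact projFlow_nonneg π (G.convex_feasible gO hw hv (by linarith [ht.2]) ht.1.le
        (by ring)).1 b
  have : (nhdsWithin (0 : ℝ) (Set.Ioo 0 1)).NeBot := by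
    rw [nhdsWithin_Ioo_eq_nhdsGT one_pos]
    infer_instance
  have h := ge_of_tendsto hlim (by filter_upwards [self_mem_nhdsWithin] with t ht using hstep t ht)
  simp only [mul_sub, Finset.sum_sub_distrib] at h
  rw [sum_mul_projFlow π v fun b => s b (projFlow π w b),
    sum_mul_projFlow π w fun b => s b (projFlow π w b)] at h
  linarith

lemma IsEquilibrium.objF_lt {G : CondensedDAG I A} {π : A → A_O} {s : A_O → ℝ → ℝ}
    (hmono : ∀ b, MonotoneOn (s b) (Set.Ici 0)) (hcont : ∀ b, ContinuousOn (s b) (Set.Ici 0))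
    {β gO : ℝ} (hβ : 0 < β) {w : A → ℝ} (hw : G.IsEquilibrium π s β gO w) {v : A → ℝ}
    (hv : v ∈ G.feasible gO) (hne : v ≠ w) : G.objF π s β w < G.objF π s β v := by
  obtain ⟨hwf, z, hz, hwz⟩ := hw
  obtain ⟨V, hV⟩ := G.exists_isLogitPotential hβ.ne'
    (c := fun a => s (π a) (projFlow π w (π a))) hz
  have hβ' := one_div_pos.2 hβ
  have hsplit : ∀ a, w a = G.outflow w (G.src a) * (Real.exp (-β * z a) /
      ∑ b ∈ Finset.univ.filter (fun b => G.src b = G.src a), Real.exp (-β * z b)) := by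
    intro a
    rw [G.outflow_eq hwf (G.src_ne_d a)]
    exact hwz a
  have h1 := G.sum_cost_add_entropy hV hwf
  have h2 := G.sum_cost_add_entropy hV hv
  rw [(G.divergence_eq_zero_iff hV.1 hwf.1).2 hsplit, mul_zero, add_zero] at h1
  have h3 := (G.divergence_nonneg hV.1 hv.1).lt_of_ne fun h0 =>
    hne (G.split_flow_unique hv hwf ((G.divergence_eq_zero_iff hV.1 hv.1).1 h0.symm) hsplit)
  have h4 := mul_pos hβ' h3
  have h5 : ∑ a, s (π a) (projFlow π w (π a)) * v a - ∑ a, s (π a) (projFlow π w (π a)) * w a ≤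
      ∑ b, (∫ u in (0 : ℝ)..projFlow π v b, s b u) -
        ∑ b, (∫ u in (0 : ℝ)..projFlow π w b, s b u) := by
    rw [← sum_mul_projFlow π v fun b => s b (projFlow π w b),
      ← sum_mul_projFlow π w fun b => s b (projFlow π w b), ← Finset.sum_sub_distrib,
      ← Finset.sum_sub_distrib]
    refine Finset.sum_le_sum fun b _ => ?_
    rw [← mul_sub]
    exact mul_sub_le_integral_sub (hmono b) (hcont b) (projFlow_nonneg π hwf.1 b)
      (projFlow_nonneg π hv.1 b)
  rw [objF_eq, objF_eq]
  linarith

lemma exists_isEquilibrium (G : CondensedDAG I A) (hR : ∃ r : List A, G.IsRoute r)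
    (π : A → A_O) {s : A_O → ℝ → ℝ}
    (hmono : ∀ b, MonotoneOn (s b) (Set.Ici 0)) (hcont : ∀ b, ContinuousOn (s b) (Set.Ici 0))
    {β gO : ℝ} (hgO : 0 ≤ gO) (hβ : 0 < β) : ∃ w, G.IsEquilibrium π s β gO w := by
  have hne : (G.feasible gO).Nonempty := by
    obtain ⟨z, hz⟩ := G.exists_latency β fun _ => 0
    obtain ⟨V, hV⟩ := G.exists_isLogitPotential hβ.ne' hz
    obtain ⟨w, hw, -⟩ := G.exists_split_flow hR hgO hV.1 hV.2.1
    exact ⟨w, hw⟩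
  obtain ⟨w, hw, hmin⟩ := (G.isCompact_feasible gO).exists_isMinOn hne
    (G.continuousOn_objF π hcont β gO)
  obtain ⟨z, hz⟩ := G.exists_latency β fun a => s (π a) (projFlow π w (π a))
  obtain ⟨V, hV⟩ := G.exists_isLogitPotential hβ.ne' hz
  obtain ⟨v, hv, hsplit⟩ := G.exists_split_flow hR hgO hV.1 hV.2.1
  have h := G.linearized_le_of_minimizer π hmono hcont hβ hw (fun x hx => hmin hx) hv
  rw [G.sum_cost_add_entropy hV hw, G.sum_cost_add_entropy hV hv,
    (G.divergence_eq_zero_iff hV.1 hv.1).2 hsplit, mul_zero, add_zero] at h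
  have h0 := le_antisymm
    (nonpos_of_mul_nonpos_right (add_le_iff_nonpos_right _ |>.1 h) (one_div_pos.2 hβ))
    (G.divergence_nonneg hV.1 hw.1)
  refine ⟨w, hw, z, hz, fun a => ?_⟩
  have ha := (G.divergence_eq_zero_iff hV.1 hw.1).1 h0 a
  rw [G.outflow_eq hw (G.src_ne_d a)] at ha
  exact ha

end Objective

end CondensedDAG
/-- the Condensed DAG equilibrium exists, is unique, and is the
unique minimizer of `F` over `W`. -/
theorem equilibrium_exists_unique_and_minimizes
    {I A : Type*} [Fintype I] [Fintype A] [DecidableEq I]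
    (G : CondensedDAG I A) (hR : ∃ r : List A, G.IsRoute r)
    (A_O : Type*) [Fintype A_O] [DecidableEq A_O]
    (π : A → A_O) (s : A_O → ℝ → ℝ)
    (hmono : ∀ b, StrictMonoOn (s b) (Set.Ici 0))
    (hcont : ∀ b, ContinuousOn (s b) (Set.Ici 0))
    (hnonneg : ∀ b, ∀ x ∈ Set.Ici (0:ℝ), 0 ≤ s b x)
    (gO β : ℝ) (hgO : 0 < gO) (hβ : 0 < β) :
    ∃ wbar : A → ℝ, G.IsEquilibrium π s β gO wbar ∧
      (∀ w' : A → ℝ, G.IsEquilibrium π s β gO w' → w' = wbar) ∧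
      (∀ w ∈ G.feasible gO, w ≠ wbar → G.objF π s β wbar < G.objF π s β w) := by
  have hmono' : ∀ b, MonotoneOn (s b) (Set.Ici 0) := fun b => (hmono b).monotoneOn
  obtain ⟨w, hw⟩ := G.exists_isEquilibrium hR π hmono' hcont hgO.le hβ
  refine ⟨w, hw, fun w' hw' => ?_, fun v hv hne => hw.objF_lt hmono' hcont hβ hv hne⟩
  by_contra hne
  exact (hw.objF_lt hmono' hcont hβ hw'.1 hne).asymm
    (hw'.objF_lt hmono' hcont hβ hw.1 (Ne.symm hne))
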